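/- Fix integers n ≥ k ≥ 0. For every 0 ≤ j ≤ 2 the function ω ↦ ω^j · ([n choose k]_q)^{(j)}(ω), as a function of ω in the group of gcd(n,k)-th roots of unity, depends only on the order of ω and takes integer values; explicitly, for a root of unity ω of order d with d | gcd(n,k): [n choose k]_ω = binom(n/d, k/d); ω · [n choose k]′_ω = binom(n/d, k/d) · k(n−k)/2; ω² · [n choose k]″_ω = binom(n/d, k/d) · k(n−k) · ( k(n−k)/4 + (nd − 5)/12 ). Moreover, if ω is an n-th root of unity of order d whose order does not divide k, then [n choose k]_ω = 0 and ω^{binom(k,2)+1} · [n choose k]′_ω = (n/(ω^k − 1)) · (−1)^{k + ⌊(k−1)/d⌋ + 1} · binom(n/d − 1, ⌊(k−1)/d⌋). -/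

import Mathlib

open Polynomial Finset

/-- The Gaussian binomial coefficient `[n choose k]_q ∈ ℤ[q]`, via the `q`-Pascal recurrence. -/
noncomputable def qBinom : ℕ → ℕ → Polynomial ℤ
  | _, 0 => 1
  | 0, _ + 1 => 0
  | n + 1, k + 1 => qBinom n k + X ^ (k + 1) * qBinom n (k + 1)

/-! ### Basic identities of the Gaussian binomials -/

theorem qb_zero (n : ℕ) : qBinom n 0 = 1 := by cases n <;> simp [qBinom]

theorem qb_succ (n k : ℕ) :
    qBinom (n + 1) (k + 1) = qBinom n k + X ^ (k + 1) * qBinom n (k + 1) := by simp [qBinom]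

theorem qb_gt (n : ℕ) : ∀ k, n < k → qBinom n k = 0 := by
  induction n with
  | zero => intro k hk; obtain ⟨k, rfl⟩ := Nat.exists_eq_succ_of_ne_zero hk.ne'; simp [qBinom]
  | succ n ih =>
    intro k hk
    obtain ⟨k, rfl⟩ := Nat.exists_eq_succ_of_ne_zero (by omega : k ≠ 0)
    rw [Nat.succ_eq_add_one, qb_succ, ih k (by omega), ih (k + 1) (by omega)]; simp

theorem qb_A (n : ℕ) : ∀ m k, n = m + k →
    qBinom n (k + 1) * (X ^ (k + 1) - 1) = qBinom n k * (X ^ m - 1) := by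
  induction n with
  | zero =>
    intro m k h
    obtain ⟨rfl, rfl⟩ : m = 0 ∧ k = 0 := by omega
    simp [qBinom]
  | succ n ih =>
    intro m k h
    rcases m with _ | m
    · rw [qb_gt (n + 1) (k + 1) (by omega)]; simp
    have h1 := ih m k (by omega)
    have hL : qBinom (n + 1) (k + 1) * (X ^ (k + 1) - 1) = qBinom n k * (X ^ (m + 1 + k) - 1) := by
      rw [qb_succ]
      linear_combination X ^ (k + 1) * h1
    rw [hL]
    rcases k with _ | k
    · simp [qb_zero]
    · have h2 := ih (m + 1) k (by omega)
      rw [qb_succ]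
      linear_combination h2

theorem qb_B (m k : ℕ) :
    qBinom (m + k + 1) (k + 1) * (X ^ (k + 1) - 1) = qBinom (m + k) k * (X ^ (m + k + 1) - 1) := by
  rw [qb_succ]
  linear_combination X ^ (k + 1) * qb_A (m + k) m k rfl

theorem qb_prod (m k : ℕ) :
    qBinom (m + k) k * ∏ i ∈ range k, (X ^ (i + 1) - 1) = ∏ i ∈ range k, (X ^ (m + (i + 1)) - 1) := by
  induction k with
  | zero => simp [qb_zero]
  | succ k ih =>
    rw [prod_range_succ, prod_range_succ, ← ih]
    have := qb_B m k
    rw [← add_assoc m k 1]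
    linear_combination (∏ i ∈ range k, ((X : ℤ[X]) ^ (i + 1) - 1)) * this

/-! ### Logarithmic two-jets -/

/-- `f` has logarithmic two-jet `(L, M)` at `w` for the Euler operator. -/
def HasJ (w : ℂ) (f : ℂ[X]) (L M : ℂ) : Prop :=
  w * (derivative f).eval w = f.eval w * L ∧
  w ^ 2 * (derivative (derivative f)).eval w = f.eval w * (M + L ^ 2 - L)

theorem HasJ.mul {w : ℂ} {f g : ℂ[X]} {L M L' M' : ℂ} (h : HasJ w f L M) (h' : HasJ w g L' M') :
    HasJ w (f * g) (L + L') (M + M') := by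
  obtain ⟨a, b⟩ := h
  obtain ⟨a', b'⟩ := h'
  constructor
  · simp only [derivative_mul, eval_add, eval_mul]
    linear_combination g.eval w * a + f.eval w * a'
  · simp only [derivative_mul, derivative_add, eval_add, eval_mul]
    linear_combination g.eval w * b + f.eval w * b' + 2 * w * (derivative g).eval w * a
      + 2 * f.eval w * L * a'

theorem HasJ.one (w : ℂ) : HasJ w 1 0 0 := by constructor <;> simp

theorem HasJ.prod {w : ℂ} {ι : Type*} (s : Finset ι) (f : ι → ℂ[X]) (L M : ι → ℂ)
    (h : ∀ i ∈ s, HasJ w (f i) (L i) (M i)) :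
    HasJ w (∏ i ∈ s, f i) (∑ i ∈ s, L i) (∑ i ∈ s, M i) := by
  classical
  induction s using Finset.induction_on with
  | empty => simpa using HasJ.one w
  | insert a s ha ih =>
    rw [prod_insert ha, sum_insert ha, sum_insert ha]
    exact (h a (by simp)).mul (ih fun i hi => h i (by simp [hi]))

theorem HasJ.unique {w : ℂ} {f : ℂ[X]} {L M L' M' : ℂ} (h : HasJ w f L M) (h' : HasJ w f L' M')
    (hf : f.eval w ≠ 0) : L = L' ∧ M = M' := by
  obtain ⟨a, b⟩ := h
  obtain ⟨a', b'⟩ := h'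
  have e : L = L' := mul_left_cancel₀ hf (a.symm.trans a')
  subst e
  have := mul_left_cancel₀ hf (b.symm.trans b')
  exact ⟨rfl, by linear_combination this⟩

theorem HasJ.of_mul {w : ℂ} {f g : ℂ[X]} {L M L' M' : ℂ} (h : HasJ w (f * g) L M)
    (h' : HasJ w g L' M') (hg : g.eval w ≠ 0) : HasJ w f (L - L') (M - M') := by
  obtain ⟨a, b⟩ := h
  obtain ⟨a', b'⟩ := h'
  simp only [derivative_mul, derivative_add, eval_add, eval_mul] at a b
  have c : w * (derivative f).eval w = f.eval w * (L - L') := by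
    apply mul_left_cancel₀ hg
    linear_combination a - f.eval w * a'
  refine ⟨c, ?_⟩
  apply mul_left_cancel₀ hg
  linear_combination b - f.eval w * b' - 2 * w * (derivative f).eval w * a'
      - 2 * eval w g * L' * c

theorem der_pow1 (w : ℂ) (i : ℕ) : w * (derivative (X ^ i : ℂ[X])).eval w = i * w ^ i := by
  rcases i with _ | i
  · simp
  · rw [derivative_X_pow]; simp; ring

theorem der_pow2 (w : ℂ) (i : ℕ) :
    w ^ 2 * (derivative (derivative (X ^ i : ℂ[X]))).eval w = i * (i - 1) * w ^ i := by
  rcases i with _ | _ | i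
  · simp
  · simp
  · rw [derivative_X_pow]; simp only [derivative_mul, derivative_C, derivative_X_pow]; simp; ring

theorem hasJ_sub (w : ℂ) (i : ℕ) (h : w ^ i - 1 ≠ 0) :
    HasJ w (X ^ i - 1) (i * (w ^ i / (w ^ i - 1))) (- (i:ℂ) ^ 2 * (w ^ i / (w ^ i - 1) ^ 2)) := by
  constructor
  · have := der_pow1 w i
    simp only [derivative_sub, derivative_one, sub_zero, eval_sub, eval_pow, eval_X, eval_one]
    rw [this]; field_simp
  · have := der_pow2 w i
    simp only [derivative_sub, derivative_one, sub_zero, eval_sub, eval_pow, eval_X, eval_one]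
    rw [this]; field_simp; ring

theorem hasJ_lin (z : ℂ) (h : 1 - z ≠ 0) :
    HasJ 1 (X - C z) (1 / (1 - z)) (- (z / (1 - z) ^ 2)) := by
  constructor
  · simp; field_simp
  · simp; right; field_simp; ring

theorem geom_jets (w : ℂ) (d a : ℕ) (hw : w ^ d = 1) :
    (∑ t ∈ range a, (X : ℂ[X]) ^ (d * t)).eval w = a ∧
    w * (derivative (∑ t ∈ range a, (X : ℂ[X]) ^ (d * t))).eval w = d * (a * (a - 1) / 2) ∧
    w ^ 2 * (derivative (derivative (∑ t ∈ range a, (X : ℂ[X]) ^ (d * t)))).eval w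
      = d ^ 2 * (a * (a - 1) * (2 * a - 1) / 6) - d * (a * (a - 1) / 2) := by
  induction a with
  | zero => simp
  | succ a ih =>
    obtain ⟨h1, h2, h3⟩ := ih
    have e1 := der_pow1 w (d * a)
    have e2 := der_pow2 w (d * a)
    have e : w ^ (d * a) = 1 := by rw [pow_mul, hw, one_pow]
    rw [e] at e1 e2
    rw [sum_range_succ]
    simp only [derivative_add, eval_add]
    refine ⟨?_, ?_, ?_⟩
    · rw [h1]; simp [e]
    · rw [mul_add, h2, e1]; push_cast; ring
    · rw [mul_add, h3, e2]; push_cast; ring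

theorem hasJ_geom (w : ℂ) (d a : ℕ) (hw : w ^ d = 1) :
    HasJ w (∑ t ∈ range a, (X : ℂ[X]) ^ (d * t)) ((((d * a : ℕ) : ℂ) - d) / 2)
      ((((d * a : ℕ) : ℂ) ^ 2 - d ^ 2) / 12) := by
  obtain ⟨h1, h2, h3⟩ := geom_jets w d a hw
  constructor
  · rw [h1, h2]; push_cast; ring
  · rw [h1, h3]; push_cast; ring

/-! ### Sums over roots of unity -/

theorem root_sums (w : ℂ) (e : ℕ) (hw : IsPrimitiveRoot w (e + 1)) :
    ∑ i ∈ range e, 1 / (1 - w ^ (i + 1)) = (e : ℂ) / 2 ∧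
    ∑ i ∈ range e, - (w ^ (i + 1) / (1 - w ^ (i + 1)) ^ 2) = (((e:ℂ) + 1) ^ 2 - 1) / 12 := by
  have hprod : ∏ i ∈ range e, ((X : ℂ[X]) - C (w ^ (i + 1))) = ∑ t ∈ range (e + 1), X ^ (1 * t) := by
    have h1 : (X : ℂ[X]) ^ (e + 1) - 1 = ∏ i ∈ range (e + 1), (X - C (w ^ i)) := by
      have := X_pow_sub_C_eq_prod hw (Nat.succ_pos e) (one_pow (M := ℂ) (e+1))
      simpa using this
    have h2 := geom_sum_mul (X : ℂ[X]) (e + 1)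
    rw [h1, prod_range_succ'] at h2
    have hne : (X : ℂ[X]) - C 1 ≠ 0 := X_sub_C_ne_zero 1
    simp only [one_mul]
    apply mul_right_cancel₀ hne
    rw [pow_zero] at h2
    rw [← h2]; simp
  have hne : ∀ i ∈ range e, 1 - w ^ (i + 1) ≠ 0 := by
    intro i hi h
    rw [mem_range] at hi
    have := hw.dvd_of_pow_eq_one (i + 1) (by linear_combination -h)
    have := Nat.le_of_dvd (by omega) this
    omega
  have j1 := HasJ.prod (range e) (fun i => (X : ℂ[X]) - C (w ^ (i + 1))) _ _
    (fun i hi => hasJ_lin _ (hne i hi))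
  rw [hprod] at j1
  have j2 := hasJ_geom 1 1 (e + 1) (by simp)
  have hv := (geom_jets 1 1 (e + 1) (by simp)).1
  obtain ⟨a, b⟩ := j1.unique j2 (by rw [hv]; exact_mod_cast Nat.succ_ne_zero e)
  refine ⟨a.trans ?_, b.trans ?_⟩
  · push_cast; ring
  · push_cast; ring

/-- The regularised first logarithmic derivative. -/
noncomputable def ell (w : ℂ) (d i : ℕ) : ℂ := if d ∣ i then 1 / 2 else w ^ i / (w ^ i - 1)

/-- The regularised second logarithmic derivative. -/
noncomputable def gam (w : ℂ) (d i : ℕ) : ℂ := if d ∣ i then 1 / 12 else - (w ^ i / (w ^ i - 1) ^ 2)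

theorem pow_per (w : ℂ) (d K i : ℕ) (hw : w ^ d = 1) : w ^ (d * K + i) = w ^ i := by
  rw [pow_add, pow_mul, hw, one_pow, one_mul]

theorem ell_per (w : ℂ) (d K i : ℕ) (hw : w ^ d = 1) : ell w d (d * K + i) = ell w d i := by
  unfold ell
  simp only [pow_per w d K i hw, Nat.dvd_add_right (Dvd.intro K rfl)]

theorem gam_per (w : ℂ) (d K i : ℕ) (hw : w ^ d = 1) : gam w d (d * K + i) = gam w d i := by
  unfold gam
  simp only [pow_per w d K i hw, Nat.dvd_add_right (Dvd.intro K rfl)]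

theorem not_dvd_small {e i : ℕ} (hi : i < e) : ¬ (e + 1) ∣ (i + 1) := by
  intro h
  have := Nat.le_of_dvd (by omega) h
  omega

theorem pow_ne {w : ℂ} {d i : ℕ} (hw : IsPrimitiveRoot w d) (h : ¬ d ∣ i) : w ^ i - 1 ≠ 0 := by
  intro h'
  exact h (hw.dvd_of_pow_eq_one i (by linear_combination h'))

theorem ell_block (w : ℂ) (e : ℕ) (hw : IsPrimitiveRoot w (e + 1)) :
    ∑ i ∈ range (e + 1), ell w (e + 1) (i + 1) = ((e : ℂ) + 1) / 2 := by
  rw [sum_range_succ]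
  have h : ∑ i ∈ range e, ell w (e + 1) (i + 1) = ∑ i ∈ range e, (1 - 1 / (1 - w ^ (i + 1))) := by
    apply sum_congr rfl
    intro i hi
    have hd := not_dvd_small (mem_range.1 hi)
    have h1 := pow_ne hw hd
    have h2 : 1 - w ^ (i + 1) ≠ 0 := by intro h; apply h1; linear_combination -h
    rw [ell, if_neg hd]
    field_simp
    ring
  rw [h, sum_sub_distrib, (root_sums w e hw).1, ell, if_pos dvd_rfl]
  simp
  ring

theorem gam_small (w : ℂ) (e : ℕ) (hw : IsPrimitiveRoot w (e + 1)) :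
    ∑ i ∈ range e, gam w (e + 1) (i + 1) = (((e : ℂ) + 1) ^ 2 - 1) / 12 := by
  rw [← (root_sums w e hw).2]
  apply sum_congr rfl
  intro i hi
  have hd := not_dvd_small (mem_range.1 hi)
  rw [gam, if_neg hd]
  congr 2
  ring

theorem gam_block (w : ℂ) (e : ℕ) (hw : IsPrimitiveRoot w (e + 1)) :
    ∑ i ∈ range (e + 1), gam w (e + 1) (i + 1) = ((e : ℂ) + 1) ^ 2 / 12 := by
  rw [sum_range_succ, gam_small w e hw, gam, if_pos dvd_rfl]
  ring

theorem gam_symm (w : ℂ) (e i : ℕ) (hw : IsPrimitiveRoot w (e + 1)) (hi : i < e) :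
    gam w (e + 1) (e - 1 - i + 1) = gam w (e + 1) (i + 1) := by
  have hd := not_dvd_small hi
  have hd' := not_dvd_small (show e - 1 - i < e by omega)
  rw [gam, gam, if_neg hd, if_neg hd']
  have h1 := pow_ne hw hd
  have h2 := pow_ne hw hd'
  have h : w ^ (e - 1 - i + 1) * w ^ (i + 1) = 1 := by
    rw [← pow_add, ← hw.pow_eq_one]; congr 1; omega
  generalize w ^ (e - 1 - i + 1) = a at *
  generalize w ^ (i + 1) = b at *
  rw [neg_inj, div_eq_div_iff (pow_ne_zero 2 h2) (pow_ne_zero 2 h1)]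
  linear_combination (b - a) * h

theorem gam_moment_small (w : ℂ) (e : ℕ) (hw : IsPrimitiveRoot w (e + 1)) :
    ∑ i ∈ range e, ((i : ℂ) + 1) * gam w (e + 1) (i + 1)
      = ((e : ℂ) + 1) / 2 * ((((e : ℂ) + 1) ^ 2 - 1) / 12) := by
  have h := sum_range_reflect (fun i : ℕ => ((i : ℂ) + 1) * gam w (e + 1) (i + 1)) e
  have h2 : ∑ i ∈ range e, (((e - 1 - i : ℕ) : ℂ) + 1) * gam w (e + 1) (e - 1 - i + 1)
      = ∑ i ∈ range e, (((e : ℂ) + 1) * gam w (e + 1) (i + 1)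
          - ((i : ℂ) + 1) * gam w (e + 1) (i + 1)) := by
    apply sum_congr rfl
    intro i hi
    rw [mem_range] at hi
    rw [gam_symm w e i hw hi]
    have : ((e - 1 - i : ℕ) : ℂ) = e - 1 - i := by
      rw [show e - 1 - i = e - (1 + i) by omega, Nat.cast_sub (by omega)]; push_cast; ring
    rw [this]; ring
  rw [h2, sum_sub_distrib, ← mul_sum, gam_small w e hw] at h
  linear_combination - h / 2

theorem ell_sum (w : ℂ) (e K : ℕ) (hw : IsPrimitiveRoot w (e + 1)) :
    ∑ i ∈ range ((e + 1) * K), ell w (e + 1) (i + 1) = K * ((e : ℂ) + 1) / 2 := by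
  induction K with
  | zero => simp
  | succ K ih =>
    rw [Nat.mul_succ, sum_range_add, ih]
    have : ∑ x ∈ range (e + 1), ell w (e + 1) ((e + 1) * K + x + 1) = ((e : ℂ) + 1) / 2 := by
      rw [← ell_block w e hw]
      apply sum_congr rfl
      intro i _
      rw [add_assoc, ell_per w (e + 1) K _ hw.pow_eq_one]
    rw [this]; push_cast; ring

theorem gam_sum (w : ℂ) (e K : ℕ) (hw : IsPrimitiveRoot w (e + 1)) :
    ∑ i ∈ range ((e + 1) * K), gam w (e + 1) (i + 1) = K * ((e : ℂ) + 1) ^ 2 / 12 := by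
  induction K with
  | zero => simp
  | succ K ih =>
    rw [Nat.mul_succ, sum_range_add, ih]
    have : ∑ x ∈ range (e + 1), gam w (e + 1) ((e + 1) * K + x + 1) = ((e : ℂ) + 1) ^ 2 / 12 := by
      rw [← gam_block w e hw]
      apply sum_congr rfl
      intro i _
      rw [add_assoc, gam_per w (e + 1) K _ hw.pow_eq_one]
    rw [this]; push_cast; ring

theorem gam_moment (w : ℂ) (e K : ℕ) (hw : IsPrimitiveRoot w (e + 1)) :
    ∑ i ∈ range ((e + 1) * K), ((i : ℂ) + 1) * gam w (e + 1) (i + 1)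
      = ((e : ℂ) + 1) * K * (((e : ℂ) + 1) ^ 2 * K + 1) / 24 := by
  induction K with
  | zero => simp
  | succ K ih =>
    rw [Nat.mul_succ, sum_range_add, ih]
    have : ∑ x ∈ range (e + 1), ((((e + 1) * K + x : ℕ) : ℂ) + 1) * gam w (e + 1) ((e + 1) * K + x + 1)
        = ((e : ℂ) + 1) * K * (((e : ℂ) + 1) ^ 2 / 12)
          + (((e : ℂ) + 1) / 2 * ((((e : ℂ) + 1) ^ 2 - 1) / 12) + ((e : ℂ) + 1) * (1 / 12)) := by
      rw [← gam_block w e hw, ← gam_moment_small w e hw]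
      have hg : gam w (e + 1) (e + 1) = 1 / 12 := by rw [gam, if_pos dvd_rfl]
      rw [← hg, ← sum_range_succ (fun i : ℕ => ((i : ℂ) + 1) * gam w (e + 1) (i + 1)), mul_sum,
        ← sum_add_distrib]
      apply sum_congr rfl
      intro i _
      rw [add_assoc ((e + 1) * K) i 1, gam_per w (e + 1) K _ hw.pow_eq_one]
      push_cast; ring
    rw [this]; push_cast; ring

/-! ### Regularised factors -/

/-- `X ^ i - 1` with the factor `X ^ d - 1` removed when `d ∣ i`. -/
noncomputable def regF (d i : ℕ) : ℂ[X] :=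
  if d ∣ i then ∑ t ∈ range (i / d), X ^ (d * t) else X ^ i - 1

/-- The removed factor. -/
noncomputable def remG (d i : ℕ) : ℂ[X] := if d ∣ i then X ^ d - 1 else 1

theorem regF_mul (d i : ℕ) : regF d i * remG d i = X ^ i - 1 := by
  unfold regF remG
  split_ifs with h
  · have := geom_sum_mul ((X : ℂ[X]) ^ d) (i / d)
    simp only [← pow_mul] at this
    rw [this, Nat.mul_div_cancel' h]
  · simp

theorem remG_ne (d i : ℕ) (hd : 0 < d) : remG d i ≠ 0 := by
  unfold remG
  split_ifs with h
  · exact (monic_X_pow_sub_C (1 : ℂ) hd.ne').ne_zero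
  · exact one_ne_zero

theorem hasJ_regF (w : ℂ) (d i : ℕ) (hw : IsPrimitiveRoot w d) :
    HasJ w (regF d i) (i * ell w d i - if d ∣ i then (d : ℂ) / 2 else 0)
      (i ^ 2 * gam w d i - if d ∣ i then (d : ℂ) ^ 2 / 12 else 0) := by
  unfold regF ell gam
  split_ifs with h
  · have := hasJ_geom w d (i / d) hw.pow_eq_one
    rw [Nat.mul_div_cancel' h] at this
    convert this using 1 <;> ring
  · have := hasJ_sub w i (pow_ne hw h)
    convert this using 1 <;> ring

theorem regF_eval (w : ℂ) (d i : ℕ) (hw : IsPrimitiveRoot w d) :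
    (regF d i).eval w = if d ∣ i then ((i / d : ℕ) : ℂ) else w ^ i - 1 := by
  unfold regF
  split_ifs with h
  · exact (geom_jets w d (i / d) hw.pow_eq_one).1
  · simp

theorem regF_eval_ne (w : ℂ) (d i : ℕ) (hw : IsPrimitiveRoot w d) (hd : 0 < d) (hi : 0 < i) :
    (regF d i).eval w ≠ 0 := by
  rw [regF_eval w d i hw]
  split_ifs with h
  · exact_mod_cast (Nat.div_pos (Nat.le_of_dvd hi h) hd).ne'
  · exact pow_ne hw h

/-- The complex Gaussian binomial. -/
noncomputable def cQ (n k : ℕ) : ℂ[X] := (qBinom n k).map (Int.castRingHom ℂ)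

theorem cQ_prod (m k : ℕ) :
    cQ (m + k) k * ∏ i ∈ range k, (X ^ (i + 1) - 1) = ∏ i ∈ range k, (X ^ (m + (i + 1)) - 1) := by
  have := congrArg (Polynomial.map (Int.castRingHom ℂ)) (qb_prod m k)
  simpa [Polynomial.map_prod, cQ] using this

theorem cQ_regF (d m' k : ℕ) (hd : 0 < d) :
    cQ (d * m' + k) k * ∏ i ∈ range k, regF d (i + 1) = ∏ i ∈ range k, regF d (d * m' + (i + 1)) := by
  have h := cQ_prod (d * m') k
  simp only [← regF_mul d, prod_mul_distrib] at h
  have hG : ∏ i ∈ range k, remG d (d * m' + (i + 1)) = ∏ i ∈ range k, remG d (i + 1) := by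
    apply prod_congr rfl
    intro i _
    unfold remG
    simp only [Nat.dvd_add_right (Dvd.intro m' rfl)]
  rw [hG, ← mul_assoc] at h
  exact mul_right_cancel₀ (prod_ne_zero_iff.2 fun i _ => remG_ne d _ hd) h

theorem cQ_eval (w : ℂ) (e m' K : ℕ) (hw : IsPrimitiveRoot w (e + 1)) :
    (cQ ((e + 1) * m' + (e + 1) * K) ((e + 1) * K)).eval w = ((m' + K).choose K : ℂ) := by
  have h := congrArg (Polynomial.eval w) (cQ_regF (e + 1) m' ((e + 1) * K) (Nat.succ_pos e))
  rw [eval_mul, eval_prod, eval_prod] at h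
  have hne : ∏ i ∈ range ((e + 1) * K), (regF (e + 1) (i + 1)).eval w ≠ 0 :=
    prod_ne_zero_iff.2 fun i _ => regF_eval_ne w _ _ hw (Nat.succ_pos e) (Nat.succ_pos i)
  apply mul_right_cancel₀ hne
  rw [h]
  clear h hne
  induction K with
  | zero => simp
  | succ K ih =>
    rw [Nat.mul_succ, prod_range_add _ ((e + 1) * K), prod_range_add _ ((e + 1) * K), ih, prod_range_succ, prod_range_succ]
    have hs : ∏ x ∈ range e, eval w (regF (e + 1) ((e + 1) * m' + ((e + 1) * K + x + 1)))
        = ∏ x ∈ range e, eval w (regF (e + 1) ((e + 1) * K + x + 1)) := by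
      apply prod_congr rfl
      intro x hx
      have hd := not_dvd_small (mem_range.1 hx)
      have h1 : ¬ (e + 1) ∣ ((e + 1) * K + x + 1) := by
        rwa [add_assoc, Nat.dvd_add_right (Dvd.intro K rfl)]
      have h2 : ¬ (e + 1) ∣ ((e + 1) * m' + ((e + 1) * K + x + 1)) := by
        rwa [Nat.dvd_add_right (Dvd.intro m' rfl)]
      rw [regF_eval w _ _ hw, regF_eval w _ _ hw, if_neg h1, if_neg h2,
        pow_per w _ _ _ hw.pow_eq_one]
    have e1 : (e + 1) * K + e + 1 = (e + 1) * (K + 1) := by ring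
    have e2 : (e + 1) * m' + (e + 1) * (K + 1) = (e + 1) * (m' + K + 1) := by ring
    rw [hs, e1, e2, regF_eval w _ _ hw, regF_eval w _ _ hw, if_pos (Dvd.intro _ rfl),
      if_pos (Dvd.intro _ rfl), Nat.mul_div_cancel_left _ (Nat.succ_pos e),
      Nat.mul_div_cancel_left _ (Nat.succ_pos e)]
    have hc : ((m' + K + 1 : ℕ) : ℂ) * ((m' + K).choose K : ℂ)
        = ((m' + (K + 1)).choose (K + 1) : ℂ) * ((K + 1 : ℕ) : ℂ) := by
      exact_mod_cast Nat.add_one_mul_choose_eq (m' + K) K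
    linear_combination (∏ x ∈ range ((e + 1) * K), eval w (regF (e + 1) (x + 1))) *
      (∏ x ∈ range e, eval w (regF (e + 1) ((e + 1) * K + x + 1))) * hc

theorem cQ_hasJ (w : ℂ) (e m' K : ℕ) (hw : IsPrimitiveRoot w (e + 1)) (m k n d : ℂ)
    (hd : d = e + 1) (hm : m = d * m') (hk : k = d * K) (hn : n = m + k) :
    HasJ w (cQ ((e + 1) * m' + (e + 1) * K) ((e + 1) * K)) (k * m / 2)
      (m * k * (n * d + 1) / 12) := by
  have h := cQ_regF (e + 1) m' ((e + 1) * K) (Nat.succ_pos e)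
  have j1 := HasJ.prod (range ((e + 1) * K)) _ _ _
    (fun i _ => hasJ_regF w (e + 1) (i + 1) hw)
  have j2 := HasJ.prod (range ((e + 1) * K)) _ _ _
    (fun i _ => hasJ_regF w (e + 1) ((e + 1) * m' + (i + 1)) hw)
  rw [← h] at j2
  have hne : (∏ i ∈ range ((e + 1) * K), (regF (e + 1) (i + 1))).eval w ≠ 0 := by
    rw [eval_prod]
    exact prod_ne_zero_iff.2 fun i _ => regF_eval_ne w _ _ hw (Nat.succ_pos e) (Nat.succ_pos i)
  have j := j2.of_mul j1 hne
  rw [← sum_sub_distrib, ← sum_sub_distrib] at j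
  have hdv : ∀ i, (e + 1) ∣ (e + 1) * m' + (i + 1) ↔ (e + 1) ∣ i + 1 :=
    fun i => Nat.dvd_add_right (Dvd.intro m' rfl)
  convert j using 1
  · have : k * m / 2 = m * ∑ i ∈ range ((e + 1) * K), ell w (e + 1) (i + 1) := by
      rw [ell_sum w e K hw, hk, hd]; ring
    rw [this, mul_sum]
    apply sum_congr rfl
    intro i _
    simp only [hdv, ell_per w (e + 1) m' _ hw.pow_eq_one]
    rw [hm, hd]; push_cast; ring
  · have : m * k * (n * d + 1) / 12 = m ^ 2 * ∑ i ∈ range ((e + 1) * K), gam w (e + 1) (i + 1)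
        + 2 * m * ∑ i ∈ range ((e + 1) * K), ((i : ℂ) + 1) * gam w (e + 1) (i + 1) := by
      rw [gam_sum w e K hw, gam_moment w e K hw, hn, hk, hm, hd]; ring
    rw [this, mul_sum, mul_sum, ← sum_add_distrib]
    apply sum_congr rfl
    intro i _
    simp only [hdv, gam_per w (e + 1) m' _ hw.pow_eq_one]
    rw [hm, hd]; push_cast; ring

/-! ### Assembly -/

theorem aeval_cQ (w : ℂ) (p : ℤ[X]) : aeval w p = (p.map (Int.castRingHom ℂ)).eval w := by
  rw [aeval_def, eval₂_eq_eval_map]; rfl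

theorem aeval_cQ0 (w : ℂ) (n k : ℕ) : aeval w (qBinom n k) = (cQ n k).eval w := aeval_cQ w _

theorem aeval_cQ1 (w : ℂ) (n k : ℕ) :
    aeval w (derivative (qBinom n k)) = (derivative (cQ n k)).eval w := by
  rw [aeval_cQ, cQ, derivative_map]

theorem aeval_cQ2 (w : ℂ) (n k : ℕ) :
    aeval w (derivative (derivative (qBinom n k))) = (derivative (derivative (cQ n k))).eval w := by
  rw [aeval_cQ, cQ, derivative_map, derivative_map]

theorem part_two (n k : ℕ) (hk : k ≤ n) (ω : ℂ) (d : ℕ) (hω : IsPrimitiveRoot ω d)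
    (hd : d ∣ Nat.gcd n k) :
    Polynomial.aeval ω (qBinom n k) = ((n / d).choose (k / d) : ℂ)
        ∧ ω * Polynomial.aeval ω (Polynomial.derivative (qBinom n k))
            = ((n / d).choose (k / d) : ℂ) * ((k * (n - k) : ℕ) : ℂ) / 2
        ∧ ω ^ 2 * Polynomial.aeval ω
              (Polynomial.derivative (Polynomial.derivative (qBinom n k)))
            = ((n / d).choose (k / d) : ℂ) * ((k * (n - k) : ℕ) : ℂ)
                * (((k * (n - k) : ℕ) : ℂ) / 4 + (((n * d : ℕ) : ℂ) - 5) / 12) := by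
  rcases d with _ | e
  · have h0 := Nat.eq_zero_of_zero_dvd hd
    obtain ⟨rfl, rfl⟩ := Nat.gcd_eq_zero_iff.1 h0
    simp [qb_zero]
  obtain ⟨K, rfl⟩ := hd.trans (Nat.gcd_dvd_right n k)
  obtain ⟨m', hm'⟩ := (Nat.dvd_sub (hd.trans (Nat.gcd_dvd_left n _))
    (Dvd.intro K rfl : (e + 1) ∣ (e + 1) * K))
  obtain rfl : n = (e + 1) * m' + (e + 1) * K := by omega
  have hv := cQ_eval ω e m' K hω
  obtain ⟨j1, j2⟩ := cQ_hasJ ω e m' K hω _ _ _ _ rfl rfl rfl rfl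
  have e1 : ((e + 1) * m' + (e + 1) * K) / (e + 1) = m' + K := by
    rw [← mul_add, Nat.mul_div_cancel_left _ (Nat.succ_pos e)]
  rw [aeval_cQ0, aeval_cQ1, aeval_cQ2, e1, Nat.mul_div_cancel_left _ (Nat.succ_pos e), hm']
  refine ⟨hv, ?_, ?_⟩
  · rw [j1, hv]; push_cast; ring
  · rw [j2, hv]; push_cast; ring

theorem rational_values (n k : ℕ) (hk : k ≤ n) (hn : 0 < n) :
    ∃ r : ℕ → ℕ → ℚ, ∀ ω : ℂ, ω ^ Nat.gcd n k = 1 → ∀ j ≤ 2,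
      ω ^ j * Polynomial.aeval ω
            ((fun p : Polynomial ℤ => Polynomial.derivative p)^[j] (qBinom n k))
        = (r (orderOf ω) j : ℂ) := by
  refine ⟨fun d j => if j = 0 then ((n / d).choose (k / d) : ℕ) else if j = 1 then
    ((n / d).choose (k / d) : ℕ) * ((k * (n - k) : ℕ) : ℚ) / 2 else
    ((n / d).choose (k / d) : ℕ) * ((k * (n - k) : ℕ) : ℚ)
                * (((k * (n - k) : ℕ) : ℚ) / 4 + (((n * d : ℕ) : ℚ) - 5) / 12), ?_⟩
  intro ω hω j hj
  obtain ⟨h0, h1, h2⟩ := part_two n k hk ω (orderOf ω) (IsPrimitiveRoot.orderOf ω)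
    (orderOf_dvd_of_pow_eq_one hω)
  interval_cases j
  · simpa using h0
  · simp only [pow_one, Function.iterate_one, if_neg one_ne_zero, if_true]
    rw [h1]; push_cast; rfl
  · simp only [Function.iterate_succ, Function.iterate_zero, Function.comp, id, OfNat.ofNat_ne_zero,
      OfNat.ofNat_ne_one, if_false]
    rw [h2]; push_cast; rfl

theorem int_of_integral (x : ℂ) (r : ℚ) (h : x = (r : ℂ)) (hx : IsIntegral ℤ x) :
    ∃ z : ℤ, x = (z : ℂ) := by
  have h1 : IsIntegral ℤ r := by
    rw [h] at hx
    exact (isIntegral_algHom_iff ((algebraMap ℚ ℂ).toIntAlgHom) (algebraMap ℚ ℂ).injective).1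
      (by simpa using hx)
  obtain ⟨z, hz⟩ := IsIntegrallyClosed.isIntegral_iff.1 h1
  refine ⟨z, ?_⟩
  rw [h, ← hz]; simp

theorem part_one (n k : ℕ) (hk : k ≤ n) : ∀ j : ℕ, j ≤ 2 →
      (∀ ω₁ ω₂ : ℂ, ω₁ ^ Nat.gcd n k = 1 → ω₂ ^ Nat.gcd n k = 1 → orderOf ω₁ = orderOf ω₂ →
        ω₁ ^ j * Polynomial.aeval ω₁
            ((fun p : Polynomial ℤ => Polynomial.derivative p)^[j] (qBinom n k))
          = ω₂ ^ j * Polynomial.aeval ω₂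
            ((fun p : Polynomial ℤ => Polynomial.derivative p)^[j] (qBinom n k)))
      ∧ ∀ ω : ℂ, ω ^ Nat.gcd n k = 1 →
        ∃ z : ℤ, ω ^ j * Polynomial.aeval ω
            ((fun p : Polynomial ℤ => Polynomial.derivative p)^[j] (qBinom n k)) = (z : ℂ) := by
  intro j hj
  rcases Nat.eq_zero_or_pos n with rfl | hn
  · obtain rfl : k = 0 := by omega
    rw [qb_zero]
    interval_cases j
    · exact ⟨by simp, fun ω _ => ⟨1, by simp⟩⟩
    · exact ⟨by simp, fun ω _ => ⟨0, by simp⟩⟩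
    · exact ⟨by simp, fun ω _ => ⟨0, by simp⟩⟩
  obtain ⟨r, hr⟩ := rational_values n k hk hn
  constructor
  · intro ω₁ ω₂ h1 h2 h
    rw [hr ω₁ h1 j hj, hr ω₂ h2 j hj, h]
  · intro ω h
    have hi : IsIntegral ℤ ω :=
      IsIntegral.of_pow (Nat.gcd_pos_of_pos_left k hn) (by rw [h]; exact isIntegral_one)
    apply int_of_integral _ _ (hr ω h j hj)
    apply (hi.pow j).mul
    exact adjoin_le_integralClosure hi (aeval_mem_adjoin_singleton ℤ ω)

theorem prod_pow_range (w : ℂ) (n : ℕ) : ∏ i ∈ range n, w ^ i = w ^ (n.choose 2) := by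
  induction n with
  | zero => simp
  | succ n ih => rw [prod_range_succ, ih, ← pow_add, Nat.choose_succ_succ' n 1, Nat.choose_one_right,
      add_comm]

theorem pow_choose_self (w : ℂ) (e : ℕ) (hw : IsPrimitiveRoot w (e + 1)) :
    w ^ ((e + 1).choose 2) = (-1) ^ e := by
  have h1 : (X : ℂ[X]) ^ (e + 1) - 1 = ∏ i ∈ range (e + 1), (X - C (w ^ i)) := by
    have := X_pow_sub_C_eq_prod hw (Nat.succ_pos e) (one_pow (M := ℂ) (e+1))
    simpa using this
  have h2 := congrArg (Polynomial.eval 0) h1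
  rw [eval_prod] at h2
  simp only [eval_sub, eval_pow, eval_X, eval_one, eval_C, zero_sub, zero_pow (Nat.succ_ne_zero e)]
    at h2
  rw [prod_neg, prod_pow_range, card_range, pow_succ] at h2
  have h3 : ((-1 : ℂ) ^ e) * (-1) ^ e = 1 := by rw [← mul_pow]; simp
  linear_combination (-1) ^ e * h2 - w ^ ((e + 1).choose 2) * h3

theorem pow_choose_mul (w : ℂ) (e J : ℕ) (hw : IsPrimitiveRoot w (e + 1)) :
    w ^ (((e + 1) * J).choose 2) = (-1) ^ ((e + 1) * J + J) := by
  rw [← prod_pow_range]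
  induction J with
  | zero => simp
  | succ J ih =>
    rw [Nat.mul_succ, prod_range_add, ih]
    have : ∏ x ∈ range (e + 1), w ^ ((e + 1) * J + x) = (-1) ^ e := by
      rw [← pow_choose_self w e hw, ← prod_pow_range]
      exact prod_congr rfl fun x _ => pow_per w _ _ _ hw.pow_eq_one
    rw [this, show (e + 1) * J + (e + 1) + (J + 1) = (e + 1) * J + J + e + 2 by ring]
    rw [pow_add _ _ 2, pow_add _ _ e]; simp

theorem cQ_B (m k : ℕ) :
    cQ (m + k + 1) (k + 1) * (X ^ (k + 1) - 1) = cQ (m + k) k * (X ^ (m + k + 1) - 1) := by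
  have := congrArg (Polynomial.map (Int.castRingHom ℂ)) (qb_B m k)
  simpa [cQ] using this

theorem cQ_zero_eval (w : ℂ) (d n' j : ℕ) (hw : IsPrimitiveRoot w d) (hn : d ∣ n' + 1)
    (hj : ¬ d ∣ j + 1) (hjn : j ≤ n') : (cQ (n' + 1) (j + 1)).eval w = 0 := by
  obtain ⟨m, rfl⟩ := Nat.exists_eq_add_of_le' hjn
  have h := congrArg (Polynomial.eval w) (cQ_B m j)
  simp only [eval_mul, eval_sub, eval_pow, eval_X, eval_one] at h
  rw [(hw.pow_eq_one_iff_dvd _).2 hn, sub_self, mul_zero] at h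
  exact (mul_eq_zero.1 h).resolve_right (pow_ne hw hj)

theorem cQ_pred_eval (w : ℂ) (e N' n' : ℕ) (hw : IsPrimitiveRoot w (e + 1))
    (hn : n' + 1 = (e + 1) * (N' + 1)) (j : ℕ) (hj : j ≤ n') :
    w ^ ((j + 1).choose 2) * (cQ n' j).eval w
      = (-1) ^ (j + j / (e + 1)) * (N'.choose (j / (e + 1)) : ℂ) := by
  induction j with
  | zero => simp [cQ, qb_zero]
  | succ j ih =>
    have ih := ih (by omega)
    have hp : cQ (n' + 1) (j + 1) = cQ n' j + X ^ (j + 1) * cQ n' (j + 1) := by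
      simp [cQ, qb_succ]
    have hp := congrArg (Polynomial.eval w) hp
    simp only [eval_mul, eval_add, eval_pow, eval_X] at hp
    have hc : (j + 1 + 1).choose 2 = (j + 1) + (j + 1).choose 2 := by
      rw [Nat.choose_succ_succ' (j + 1) 1, Nat.choose_one_right]
    rw [hc, pow_add]
    by_cases hd : (e + 1) ∣ j + 1
    · obtain ⟨J, hJ⟩ := hd
      rcases J with _ | J
      · omega
      have hle : J ≤ N' := by
        have : (e + 1) * (J + 1) ≤ (e + 1) * (N' + 1) := by omega
        have := Nat.le_of_mul_le_mul_left this (Nat.succ_pos e)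
        omega
      obtain ⟨m', rfl⟩ := Nat.exists_eq_add_of_le' hle
      have h1 : (cQ (n' + 1) (j + 1)).eval w = ((m' + J + 1).choose (J + 1) : ℂ) := by
        have := cQ_eval w e m' (J + 1) hw
        rw [← mul_add, ← add_assoc, ← hn, ← hJ] at this
        exact this
      have h2 : w ^ ((j + 1).choose 2) = (-1) ^ (j + 1 + (J + 1)) := by
        rw [hJ]; exact pow_choose_mul w e (J + 1) hw
      have h3 : j / (e + 1) = J := by
        apply Nat.div_eq_of_lt_le
        · have : (e + 1) * (J + 1) = J * (e + 1) + (e + 1) := by ring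
          omega
        · have : (e + 1) * (J + 1) = (J + 1) * (e + 1) := by ring
          rw [← this]; omega
      have h4 : (j + 1) / (e + 1) = J + 1 := by
        rw [hJ, Nat.mul_div_cancel_left _ (Nat.succ_pos e)]
      rw [h3] at ih
      rw [h4]
      rw [h1, Nat.choose_succ_succ' (m' + J) J] at hp
      push_cast at hp
      rw [h2] at ih ⊢
      have h5 : (-1 : ℂ) ^ (j + 1 + (J + 1)) = (-1) ^ (j + J) := by
        rw [show j + 1 + (J + 1) = j + J + 2 by ring, pow_add]; simp
      rw [h5] at ih ⊢
      linear_combination (-(-1) ^ (j + J)) * hp - ih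
    · have h1 := cQ_zero_eval w (e + 1) n' j hw (Dvd.intro _ hn.symm) hd (by omega)
      have h4 : (j + 1) / (e + 1) = j / (e + 1) := by
        rw [Nat.succ_div, if_neg hd, add_zero]
      rw [h1] at hp
      rw [h4, show j + 1 + j / (e + 1) = j + j / (e + 1) + 1 by ring, pow_succ]
      linear_combination (-w ^ ((j + 1).choose 2)) * hp - ih

theorem part_three (n k : ℕ) (hk : k ≤ n) (ω : ℂ) (d : ℕ) (hω : ω ^ n = 1) (hd : d = orderOf ω)
    (hdk : ¬ d ∣ k) :
    Polynomial.aeval ω (qBinom n k) = 0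
        ∧ ω ^ (k.choose 2 + 1) * Polynomial.aeval ω (Polynomial.derivative (qBinom n k))
            = (n : ℂ) / (ω ^ k - 1) * (-1 : ℂ) ^ (k + (k - 1) / d + 1)
                * ((n / d - 1).choose ((k - 1) / d) : ℂ) := by
  have hw : IsPrimitiveRoot ω d := hd ▸ IsPrimitiveRoot.orderOf ω
  have hdn : d ∣ n := hw.dvd_of_pow_eq_one n hω
  rcases k with _ | j
  · exact absurd (dvd_zero d) hdk
  rcases n with _ | n'
  · omega
  rcases d with _ | e
  · simp at hdn
  obtain ⟨N, hN⟩ := hdn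
  rcases N with _ | N'
  · simp at hN
  have hjn : j ≤ n' := by omega
  have h0 := cQ_zero_eval ω (e + 1) n' j hw (Dvd.intro _ hN.symm) hdk hjn
  have hb := cQ_pred_eval ω e N' n' hw hN j hjn
  rw [aeval_cQ0, aeval_cQ1]
  refine ⟨h0, ?_⟩
  obtain ⟨m, rfl⟩ := Nat.exists_eq_add_of_le' hjn
  have h := congrArg (fun p => ω * Polynomial.eval ω (derivative p)) (cQ_B m j)
  have e1 := der_pow1 ω (m + j + 1)
  simp only [derivative_mul, derivative_sub, derivative_one, sub_zero, eval_mul, eval_add, eval_sub,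
    eval_pow, eval_X, eval_one, h0, hω] at h
  rw [hω] at e1
  have hne := pow_ne hw hdk
  rw [hN, Nat.mul_div_cancel_left _ (Nat.succ_pos e), ← hN]
  simp only [Nat.add_sub_cancel]
  have h6 : (-1 : ℂ) ^ (j + 1 + j / (e + 1) + 1) = (-1) ^ (j + j / (e + 1)) := by
    rw [show j + 1 + j / (e + 1) + 1 = j + j / (e + 1) + 2 by ring, pow_add]; simp
  rw [h6, mul_assoc, ← hb, pow_succ, div_mul_eq_mul_div, eq_div_iff hne]
  linear_combination ω ^ ((j + 1).choose 2) * h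
    + ω ^ ((j + 1).choose 2) * eval ω (cQ (m + j) j) * e1

/-- Values of the Gaussian binomial coefficient and its first two derivatives at roots of
unity: dependence only on the order, integrality, explicit formulas on `μ_{gcd(n,k)}`, and the
formulas at `n`-th roots of unity whose order does not divide `k`. -/
theorem stmt15 (n k : ℕ) (hk : k ≤ n) :
    (∀ j : ℕ, j ≤ 2 →
      (∀ ω₁ ω₂ : ℂ, ω₁ ^ Nat.gcd n k = 1 → ω₂ ^ Nat.gcd n k = 1 → orderOf ω₁ = orderOf ω₂ →
        ω₁ ^ j * Polynomial.aeval ω₁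
            ((fun p : Polynomial ℤ => Polynomial.derivative p)^[j] (qBinom n k))
          = ω₂ ^ j * Polynomial.aeval ω₂
            ((fun p : Polynomial ℤ => Polynomial.derivative p)^[j] (qBinom n k)))
      ∧ ∀ ω : ℂ, ω ^ Nat.gcd n k = 1 →
        ∃ z : ℤ, ω ^ j * Polynomial.aeval ω
            ((fun p : Polynomial ℤ => Polynomial.derivative p)^[j] (qBinom n k)) = (z : ℂ))
    ∧ (∀ (ω : ℂ) (d : ℕ), IsPrimitiveRoot ω d → d ∣ Nat.gcd n k →
        Polynomial.aeval ω (qBinom n k) = ((n / d).choose (k / d) : ℂ)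
        ∧ ω * Polynomial.aeval ω (Polynomial.derivative (qBinom n k))
            = ((n / d).choose (k / d) : ℂ) * ((k * (n - k) : ℕ) : ℂ) / 2
        ∧ ω ^ 2 * Polynomial.aeval ω
              (Polynomial.derivative (Polynomial.derivative (qBinom n k)))
            = ((n / d).choose (k / d) : ℂ) * ((k * (n - k) : ℕ) : ℂ)
                * (((k * (n - k) : ℕ) : ℂ) / 4 + (((n * d : ℕ) : ℂ) - 5) / 12))
    ∧ (∀ (ω : ℂ) (d : ℕ), ω ^ n = 1 → d = orderOf ω → ¬ d ∣ k →
        Polynomial.aeval ω (qBinom n k) = 0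
        ∧ ω ^ (k.choose 2 + 1) * Polynomial.aeval ω (Polynomial.derivative (qBinom n k))
            = (n : ℂ) / (ω ^ k - 1) * (-1 : ℂ) ^ (k + (k - 1) / d + 1)
                * ((n / d - 1).choose ((k - 1) / d) : ℂ)) := by
  exact ⟨part_one n k hk, part_two n k hk, part_three n k hk⟩
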